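/- arXiv:2402.18477 — 2 statements merged into one kernel-verified Lean document; each statement's English description precedes it below -/
import Mathlib

section
/- Let G = (V, E) be a DAG with self-loops and G̃ its lifted graph. For all distinct i, j ∈ V: the edge (i → j) belongs to E if and only if for every subset K ⊆ V \ {i, j}, the vertices i₀ and j₁ are d-connected in G̃ given the conditioning set {j₀} ∪ {k₀ : k ∈ K} ∪ {k₁ : k ∈ K}. (d-separation-oracle form of the edge-recovery phase of Theorem 1: Algorithm 1 deletes exactly the non-edges.) -/
open Sum

/-- `G = (V, E)` is a DAG with self-loops: every directed cycle stays at a single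
vertex, i.e., is a self-loop. -/
def IsDAGWithLoops {V : Type*} (E : V → V → Prop) : Prop :=
  ∀ (k : ℕ) (w : ℕ → V), 1 ≤ k → w k = w 0 →
    (∀ l < k, E (w l) (w (l + 1))) → ∀ l ≤ k, w l = w 0

/-- The edge relation of the lifted graph `G̃` on `Ṽ = V₀ ⊔ V₁` (`inl i = i₀`,
`inr i = i₁`): `i₀ → i₁` for every self-loop `i → i`, and `i₀ → j₀`, `i₁ → j₁`,
`i₀ → j₁` for every edge `i → j` with `i ≠ j`. -/
def liftedEdge {V : Type*} (E : V → V → Prop) : V ⊕ V → V ⊕ V → Prop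
  | .inl i, .inl j => i ≠ j ∧ E i j
  | .inl i, .inr j => (i = j ∧ E i i) ∨ (i ≠ j ∧ E i j)
  | .inr i, .inr j => i ≠ j ∧ E i j
  | .inr _, .inl _ => False

/-- The parents of `j`: `pa(j) = {i : (i → j) ∈ E}`. -/
def parents {V : Type*} (E : V → V → Prop) (j : V) : Set V := {i | E i j}


/-- `v 0, …, v m` is a path between `a` and `b` in the directed graph with edge
relation `F`: at least one edge (`m ≥ 1`, i.e. at least two vertices), endpoints
`a` and `b`, pairwise distinct vertices, and consecutive vertices joined by an
edge in one direction or the other. -/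
def IsPath {W : Type*} (F : W → W → Prop) (a b : W) (m : ℕ) (v : ℕ → W) : Prop :=
  1 ≤ m ∧ v 0 = a ∧ v m = b ∧
  (∀ l ≤ m, ∀ l' ≤ m, v l = v l' → l = l') ∧
  (∀ l < m, F (v l) (v (l + 1)) ∨ F (v (l + 1)) (v l))

/-- The interior vertex `v l` is a collider on the path `v`. -/
def IsCollider {W : Type*} (F : W → W → Prop) (v : ℕ → W) (l : ℕ) : Prop :=
  F (v (l - 1)) (v l) ∧ F (v (l + 1)) (v l)

/-- The path `v 0, …, v m` is blocked by the conditioning set `C`: it contains an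
interior non-collider vertex belonging to `C`, or an interior collider vertex
none of whose descendants (via `Relation.ReflTransGen F`) belongs to `C`. -/
def Blocked {W : Type*} (F : W → W → Prop) (C : Set W) (m : ℕ) (v : ℕ → W) : Prop :=
  ∃ l, 0 < l ∧ l < m ∧
    ((¬ IsCollider F v l ∧ v l ∈ C) ∨
      (IsCollider F v l ∧ ∀ u, Relation.ReflTransGen F (v l) u → u ∉ C))

/-- `a` and `b` are d-separated given `C`: every path between them is blocked. -/
def DSep {W : Type*} (F : W → W → Prop) (a b : W) (C : Set W) : Prop :=
  ∀ (m : ℕ) (v : ℕ → W), IsPath F a b m v → Blocked F C m v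

/-- The vertex sets `A` and `B` are d-separated given `C`. -/
def DSepSet {W : Type*} (F : W → W → Prop) (A B C : Set W) : Prop :=
  ∀ a ∈ A, ∀ b ∈ B, DSep F a b C


theorem aux_seq {V : Type*} {E : V → V → Prop} {a b : V} (h : Relation.ReflTransGen E a b) :
    ∃ (k : ℕ) (w : ℕ → V), w 0 = a ∧ w k = b ∧ ∀ l < k, E (w l) (w (l + 1)) := by
  induction h using Relation.ReflTransGen.head_induction_on with
  | refl => exact ⟨0, fun _ => b, rfl, rfl, by simp⟩
  | @head a' c hac _ ih =>
    obtain ⟨k, w, h0, hk, hw⟩ := ih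
    refine ⟨k + 1, fun n => Nat.casesOn n a' w, rfl, hk, ?_⟩
    intro l hl
    cases l with
    | zero => simpa [h0] using hac
    | succ l => exact hw l (by omega)

theorem aux_anti {V : Type*} {E : V → V → Prop} (hG : IsDAGWithLoops E) {a b : V}
    (hab : E a b) (h : Relation.ReflTransGen E b a) : a = b := by
  obtain ⟨k, w, h0, hk, hw⟩ := aux_seq h
  have := hG (k + 1) (fun n => Nat.casesOn n a w) (by omega) hk (by
    intro l hl
    cases l with
    | zero => simpa [h0] using hab
    | succ l => exact hw l (by omega)) 1 (by omega)
  exact (h0.symm.trans this).symm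

theorem aux_edge {V : Type*} {E : V → V → Prop} {d : V} {u : V ⊕ V}
    (h : liftedEdge E (Sum.inr d) u) : ∃ e, u = Sum.inr e ∧ d ≠ e ∧ E d e := by
  cases u with
  | inl e => exact h.elim
  | inr e => exact ⟨e, rfl, h.1, h.2⟩

theorem aux_desc {V : Type*} {E : V → V → Prop} {d : V} {u : V ⊕ V}
    (h : Relation.ReflTransGen (liftedEdge E) (Sum.inr d) u) :
    ∃ e, u = Sum.inr e ∧ Relation.ReflTransGen E d e := by
  induction h with
  | refl => exact ⟨d, rfl, .refl⟩
  | tail _ h ih =>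
    obtain ⟨e, rfl, he⟩ := ih
    obtain ⟨f, rfl, -, hf⟩ := aux_edge h
    exact ⟨f, rfl, he.tail hf⟩

/-- d-separation-oracle form of the edge-recovery phase of
Theorem 1. For distinct `i, j`: the edge `(i → j)` belongs to `E` iff for every
subset `K ⊆ V \ {i, j}` the vertices `i₀` and `j₁` are d-connected in `G̃`
given `{j₀} ∪ {k₀ : k ∈ K} ∪ {k₁ : k ∈ K}`. -/
theorem edge_iff_dconnected {V : Type*} [Fintype V] (E : V → V → Prop)
    (hG : IsDAGWithLoops E) (i j : V) (hij : i ≠ j) :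
    E i j ↔ ∀ K : Set V, i ∉ K → j ∉ K →
      ¬ DSep (liftedEdge E) (Sum.inl i) (Sum.inr j)
        ({Sum.inl j} ∪ Sum.inl '' K ∪ Sum.inr '' K) := by
  constructor
  · intro hE K _ _ hs
    obtain ⟨l, h1, h2, -⟩ := hs 1 (fun n => Nat.casesOn n (Sum.inl i) (fun _ => Sum.inr j))
      ⟨le_rfl, rfl, rfl, by
        intro l hl l' hl'
        interval_cases l <;> interval_cases l' <;> simp, by
        intro l hl
        interval_cases l
        exact Or.inl (Or.inr ⟨hij, hE⟩)⟩
    omega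
  · intro h
    by_contra hE
    refine h {k | k ≠ j ∧ E k j} (fun h => hE h.2) (fun h => h.1 rfl) ?_
    rintro m v ⟨hm, h0, hvm, -, hadj⟩
    by_contra hb
    obtain ⟨n, rfl⟩ : ∃ n, m = n + 1 := ⟨m - 1, by omega⟩
    have key : ∀ t ≤ n, ∃ d, v (n - t) = Sum.inr d ∧ Relation.ReflTransGen E j d ∧
        liftedEdge E (v (n - t + 1)) (v (n - t)) := by
      intro t
      induction t with
      | zero =>
        intro _
        rcases hadj n (by omega) with hF | hF
        · exfalso
          have hn : 0 < n := by
            rcases Nat.eq_zero_or_pos n with rfl | hn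
            · rw [h0, hvm] at hF
              rcases hF with hF | hF
              · exact (hij hF.1).elim
              · exact (hE hF.2).elim
            · exact hn
          refine hb ⟨n, hn, by omega, Or.inl ⟨?_, ?_⟩⟩
          · rintro ⟨-, hc⟩
            rw [hvm] at hc hF
            obtain ⟨e, he, hne, hje⟩ := aux_edge hc
            rw [he] at hF
            exact hne (aux_anti hG hje (.single hF.2))
          · rw [hvm] at hF
            rcases hv : v n with k | k
            · rw [hv] at hF
              rcases hF with ⟨rfl, -⟩ | hF
              · simp
              · left; right; exact ⟨k, hF, rfl⟩
            · rw [hv] at hF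
              right; exact ⟨k, hF, rfl⟩
        · have hF' := hF
          rw [hvm] at hF'
          obtain ⟨e, he, hne, hje⟩ := aux_edge hF'
          exact ⟨e, he, .single hje, hF⟩
      | succ t ih =>
        intro ht
        obtain ⟨d, hd, hjd, hF⟩ := ih (by omega)
        obtain ⟨l, hl⟩ : ∃ l, n - t = l + 1 := ⟨n - t - 1, by omega⟩
        have hl' : n - (t + 1) = l := by omega
        rw [hl] at hd hF
        rw [hl']
        rcases hadj l (by omega) with hG' | hG'
        · exfalso
          refine hb ⟨l + 1, by omega, by omega, Or.inr ⟨⟨hG', hF⟩, ?_⟩⟩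
          intro u hu huC
          rw [hd] at hu
          obtain ⟨e, rfl, he⟩ := aux_desc hu
          have : e ≠ j ∧ E e j := by simpa using huC
          exact this.1 (aux_anti hG this.2 (hjd.trans he))
        · have hF' := hG'
          rw [hd] at hF'
          obtain ⟨e, he, hne, hje⟩ := aux_edge hF'
          exact ⟨e, he, hjd.tail hje, hG'⟩
    obtain ⟨d, hd, -⟩ := key n le_rfl
    rw [Nat.sub_self, h0] at hd
    cases hd
end

section
/- Directed local Markov property for the symmetric independence criterion (abstract form of the Proposition in Appendix A.9): In the recursive σ-algebra system over the finite DAG G = (V, E), for every i ∈ V one has 𝒳_i ⫫ (⋁_{j ∈ nd(i) \ pa(i)} 𝒳_j) | (⋁_{k ∈ pa(i)} 𝒳_k), i.e., each variable's σ-algebra is conditionally independent of the join of the σ-algebras of its non-descendants that are not its parents, given the join of its parents' σ-algebras. -/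
open ProbabilityTheory

open Sum

/-- `E` is acyclic: the directed graph has no directed cycle at all
(in particular no self-loops). -/
def IsAcyclicGraph {V : Type*} (E : V → V → Prop) : Prop :=
  ∀ (k : ℕ) (w : ℕ → V), 1 ≤ k → w k = w 0 →
    ¬ (∀ l < k, E (w l) (w (l + 1)))

/-- The ancestors of `j` (including `j` itself): vertices admitting a directed
path to `j`. -/
def ancestors {V : Type*} (E : V → V → Prop) (j : V) : Set V :=
  {k | Relation.ReflTransGen E k j}

/-- The non-descendants of `i`: vertices `j ≠ i` with no directed path from `i`
to `j`. -/
def nonDescendants {V : Type*} (E : V → V → Prop) (i : V) : Set V :=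
  {j | j ≠ i ∧ ¬ Relation.ReflTransGen E i j}


open MeasureTheory in
theorem lm_condExp {Ω : Type*} {mΩ : MeasurableSpace Ω} (μ : Measure Ω) [IsProbabilityMeasure μ]
    {A B C : MeasurableSpace Ω} (hA : A ≤ mΩ) (hB : B ≤ mΩ) (hCB : C ≤ B)
    (h : Indep A B μ) {a b : Set Ω} (ha : MeasurableSet[A] a) (hb : MeasurableSet[B] b) :
    μ⟦a ∩ b | C⟧ =ᵐ[μ] fun ω => μ.real a * (μ⟦b | C⟧) ω := by
  have hC : C ≤ mΩ := hCB.trans hB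
  have hint : ∀ s : Set Ω, MeasurableSet[mΩ] s → Integrable (s.indicator fun _ => (1 : ℝ)) μ :=
    fun s hs => (integrable_const (1 : ℝ)).indicator hs
  symm
  refine ae_eq_condExp_of_forall_setIntegral_eq hC (hint _ ((hA _ ha).inter (hB _ hb))) ?_ ?_ ?_
  · intro s _ _
    exact (integrable_condExp.const_mul _).integrableOn
  · intro s hs _
    rw [integral_const_mul, setIntegral_condExp hC (hint _ (hB _ hb)) hs,
      integral_indicator_const _ (hB _ hb), integral_indicator_const _ ((hA _ ha).inter (hB _ hb))]
    simp only [smul_eq_mul, mul_one]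
    rw [measureReal_restrict_apply (hB _ hb),
      measureReal_restrict_apply ((hA _ ha).inter (hB _ hb)), Set.inter_assoc]
    simp only [Measure.real]
    rw [(Indep_iff _ _ _).1 h a (b ∩ s) ha (MeasurableSet.inter hb (hCB _ hs)), ENNReal.toReal_mul]
  · exact (stronglyMeasurable_condExp.const_mul _).aestronglyMeasurable

open MeasureTheory in
theorem lm_condIndep {Ω : Type*} {mΩ : MeasurableSpace Ω} [StandardBorelSpace Ω]
    (μ : Measure Ω) [IsProbabilityMeasure μ]
    {A B C : MeasurableSpace Ω} (hA : A ≤ mΩ) (hB : B ≤ mΩ) (hCB : C ≤ B) (hC : C ≤ mΩ)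
    (h : Indep A B μ) : CondIndep C (A ⊔ C) B hC μ := by
  have hint : ∀ s : Set Ω, MeasurableSet[mΩ] s → Integrable (s.indicator fun _ => (1 : ℝ)) μ :=
    fun s hs => (integrable_const (1 : ℝ)).indicator hs
  refine CondIndepSets.condIndep
    (p1 := Set.image2 (· ∩ ·) {s | MeasurableSet[A] s} {s | MeasurableSet[C] s})
    (p2 := {s | MeasurableSet[B] s}) (sup_le hA hC) hB ?_ ?_ ?_ ?_ ?_
  · rintro _ ⟨a, ha, c, hc, rfl⟩ _ ⟨a', ha', c', hc', rfl⟩ _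
    refine ⟨a ∩ a', MeasurableSet.inter ha ha', c ∩ c', MeasurableSet.inter hc hc', ?_⟩
    exact Set.inter_inter_inter_comm _ _ _ _
  · exact @MeasurableSpace.isPiSystem_measurableSet _ B
  · apply le_antisymm
    · refine sup_le ?_ ?_
      · intro s hs
        exact MeasurableSpace.measurableSet_generateFrom
          ⟨s, hs, Set.univ, MeasurableSet.univ, Set.inter_univ s⟩
      · intro s hs
        exact MeasurableSpace.measurableSet_generateFrom
          ⟨Set.univ, MeasurableSet.univ, s, hs, Set.univ_inter s⟩
    · refine MeasurableSpace.generateFrom_le ?_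
      rintro _ ⟨a, ha, c, hc, rfl⟩
      exact MeasurableSet.inter ((le_sup_left : A ≤ A ⊔ C) _ ha) ((le_sup_right : C ≤ A ⊔ C) _ hc)
  · exact (@MeasurableSpace.generateFrom_measurableSet _ B).symm
  · rw [condIndepSets_iff]
    · rintro _ b ⟨a, ha, c, hc, rfl⟩ hb
      have h1 := lm_condExp μ hA hB hCB h ha (MeasurableSet.inter (hCB _ hc) hb)
      have h2 := lm_condExp μ hA hB hCB h ha (hCB _ hc)
      have h3 : μ⟦c ∩ b | C⟧ =ᵐ[μ] c.indicator (μ⟦b | C⟧) := by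
        have := condExp_indicator (m := C) (hint b (hB _ hb)) hc
        rwa [Set.indicator_indicator] at this
      have h4 : μ⟦c | C⟧ = c.indicator fun _ => (1 : ℝ) :=
        condExp_of_stronglyMeasurable hC (stronglyMeasurable_const.indicator hc) (hint c (hC _ hc))
      rw [h4] at h2
      simp only [Set.inter_assoc]
      filter_upwards [h1, h2, h3] with ω e1 e2 e3
      rw [Pi.mul_apply, e1, e2, e3]
      by_cases hω : ω ∈ c <;> simp [hω]
    · rintro _ ⟨a, ha, c, hc, rfl⟩
      exact (hA _ ha).inter (hC _ hc)
    · exact fun s hs => hB _ hs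

theorem lm_path {V : Type*} {E : V → V → Prop} {a b : V} (h : Relation.TransGen E a b) :
    ∃ (k : ℕ) (w : ℕ → V), 1 ≤ k ∧ w 0 = a ∧ w k = b ∧ ∀ l < k, E (w l) (w (l + 1)) := by
  induction h with
  | @single b h =>
    refine ⟨1, fun n => if n = 0 then a else b, le_rfl, by simp, by simp, ?_⟩
    intro l hl
    obtain rfl : l = 0 := by omega
    simpa using h
  | @tail b c _ h ih =>
    obtain ⟨k, w, hk, h0, hkb, hw⟩ := ih
    refine ⟨k + 1, fun n => if n ≤ k then w n else c, by omega, by simp [h0], by simp, ?_⟩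
    intro l hl
    rcases Nat.lt_or_ge l k with h' | h'
    · have h1 : l ≤ k := h'.le
      have h2 : l + 1 ≤ k := h'
      simpa [h1, h2] using hw l h'
    · obtain rfl : l = k := by omega
      simpa [hkb] using h

theorem lm_irrefl {V : Type*} {E : V → V → Prop} (hE : IsAcyclicGraph E) (a : V) :
    ¬ Relation.TransGen E a a := by
  intro h
  obtain ⟨k, w, hk, h0, h1, hw⟩ := lm_path h
  exact hE k w hk (h1.trans h0.symm) hw

theorem lm_wf {V : Type*} [Finite V] {E : V → V → Prop} (hE : IsAcyclicGraph E) :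
    WellFounded E := by
  have : Std.Irrefl (Relation.TransGen E) := ⟨lm_irrefl hE⟩
  have : IsTrans V (Relation.TransGen E) := ⟨fun _ _ _ => Relation.TransGen.trans⟩
  exact Subrelation.wf (fun h => Relation.TransGen.single h)
    (Finite.wellFounded_of_trans_of_irrefl (Relation.TransGen E))

/-- directed local Markov property for the symmetric
independence criterion, Appendix A.9, abstract form. In the recursive
σ-algebra system over a finite DAG `G = (V, E)`, each `X i` is conditionally
independent of the join of the `X j` over the non-descendants `j` of `i` that
are not parents of `i`, given the join of the parents' σ-algebras. -/
theorem local_markov_property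
    {Ω V : Type*} [Fintype V] {mΩ : MeasurableSpace Ω} [StandardBorelSpace Ω]
    (μ : MeasureTheory.Measure Ω) [MeasureTheory.IsProbabilityMeasure μ]
    (E : V → V → Prop) (hE : IsAcyclicGraph E)
    (W I X : V → MeasurableSpace Ω)
    (hW : ∀ i, W i ≤ mΩ) (hI : ∀ i, I i ≤ mΩ) (hX : ∀ i, X i ≤ mΩ)
    (hIndep : iIndep (Sum.elim W I) μ)
    (hRec : ∀ i, X i ≤ W i ⊔ I i ⊔ ⨆ k ∈ parents E i, X k)
    (i : V)
    (hpa : (⨆ k ∈ parents E i, X k) ≤ mΩ) :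
    CondIndep (⨆ k ∈ parents E i, X k) (X i)
      (⨆ j ∈ nonDescendants E i \ parents E i, X j) hpa μ := by
  set T : Set (V ⊕ V) := {s | s ≠ Sum.inl i ∧ s ≠ Sum.inr i} with hT
  set S : Set (V ⊕ V) := {s | s = Sum.inl i ∨ s = Sum.inr i} with hS
  have hle : ∀ s, Sum.elim W I s ≤ mΩ := by
    rintro (s | s)
    · exact hW s
    · exact hI s
  have hST : Disjoint S T := by
    rw [Set.disjoint_left]
    rintro s (h | h) ⟨h1, h2⟩
    · exact h1 h
    · exact h2 h
  have hind := indep_iSup_of_disjoint hle hIndep hST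
  have hXT : ∀ j, ¬ Relation.ReflTransGen E i j → X j ≤ ⨆ s ∈ T, Sum.elim W I s := by
    intro j
    induction j using (lm_wf hE).induction with
    | _ j ih =>
      intro hj
      have hji : j ≠ i := by
        rintro rfl
        exact hj Relation.ReflTransGen.refl
      refine (hRec j).trans (sup_le (sup_le ?_ ?_) ?_)
      · exact le_iSup₂_of_le (f := fun s (_ : s ∈ T) => Sum.elim W I s) (Sum.inl j)
          ⟨by simpa using hji, by simp⟩ le_rfl
      · exact le_iSup₂_of_le (f := fun s (_ : s ∈ T) => Sum.elim W I s) (Sum.inr j)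
          ⟨by simp, by simpa using hji⟩ le_rfl
      · exact iSup₂_le fun k hk => ih k hk fun hik => hj (hik.tail hk)
  have hC : (⨆ k ∈ parents E i, X k) ≤ ⨆ s ∈ T, Sum.elim W I s := by
    refine iSup₂_le fun k hk => hXT k fun hik => ?_
    exact lm_irrefl hE i (Relation.TransGen.tail' hik hk)
  have key := lm_condIndep μ (iSup₂_le fun s _ => hle s) (iSup₂_le fun s _ => hle s) hC hpa hind
  refine condIndep_of_condIndep_of_le_left (condIndep_of_condIndep_of_le_right key ?_) ?_
  · exact iSup₂_le fun j hj => hXT j hj.1.2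
  · refine (hRec i).trans (sup_le_sup_right (sup_le ?_ ?_) _)
    · exact le_iSup₂_of_le (f := fun s (_ : s ∈ S) => Sum.elim W I s) (Sum.inl i)
        (Or.inl rfl) le_rfl
    · exact le_iSup₂_of_le (f := fun s (_ : s ∈ S) => Sum.elim W I s) (Sum.inr i)
        (Or.inr rfl) le_rfl
end
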